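/- There is an absolute constant c > 0, independent of the dimension n, such that for every n ≥ 1, every weight ω on ℝ with dyadic A₂ characteristic Q₂(ω) < ∞, every dyadic interval J, every finite family F of dyadic subintervals of J, and all functions f, g : ℝ → ℝⁿ with ∫_J ‖f‖² ω dx < ∞ and ∫_J ‖g‖² ω⁻¹ dx < ∞, one has (1/|J|) Σ_{I ∈ F} ‖⟨f, h_I⟩‖ · ‖⟨g, h_I⟩‖ ≤ c · Q₂(ω) · ( (1/|J|)∫_J ‖f‖² ω dx + (1/|J|)∫_J ‖g‖² ω⁻¹ dx ), where ⟨f, h_I⟩ = ∫_ℝ f(x) h_I(x) dx ∈ ℝⁿ. -/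

import Mathlib

open MeasureTheory
open scoped ENNReal

noncomputable section

/-- Euclidean space ℝⁿ. -/
abbrev En (n : ℕ) := EuclideanSpace ℝ (Fin n)

/-- The dyadic interval `[2^k m, 2^k (m+1))`. -/
def dyadicI (k m : ℤ) : Set ℝ := Set.Ico ((2 : ℝ) ^ k * (m : ℝ)) ((2 : ℝ) ^ k * ((m : ℝ) + 1))

/-- The Haar function of the dyadic interval `I = [2^k m, 2^k(m+1))`:
`h_I = |I|^{-1/2} (𝟙_{I₊} − 𝟙_{I₋})`, where `I₋, I₊` are the left and right halves. -/
def haarF (k m : ℤ) (x : ℝ) : ℝ :=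
  (Real.sqrt ((2 : ℝ) ^ k))⁻¹ *
    ((dyadicI (k - 1) (2 * m + 1)).indicator (fun _ => (1 : ℝ)) x -
      (dyadicI (k - 1) (2 * m)).indicator (fun _ => (1 : ℝ)) x)

/-- The Haar coefficient `⟨f, h_I⟩ = ∫ f(x) h_I(x) dx ∈ ℝⁿ`. -/
def haarCoeff {n : ℕ} (f : ℝ → En n) (k m : ℤ) : En n := ∫ x : ℝ, haarF k m x • f x

/-- The dyadic A₂ characteristic `Q₂(ω) = sup_{I ∈ 𝒟} ⟨ω⟩_I ⟨ω⁻¹⟩_I`. -/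
def Q2dyadic (ω : ℝ → ℝ) : ℝ≥0∞ :=
  ⨆ (k : ℤ) (m : ℤ),
    ((∫⁻ x in dyadicI k m, ENNReal.ofReal (ω x)) / ENNReal.ofReal ((2 : ℝ) ^ k)) *
      ((∫⁻ x in dyadicI k m, ENNReal.ofReal ((ω x)⁻¹)) / ENNReal.ofReal ((2 : ℝ) ^ k))

/-- Carleson-type correction of `v`, concave along dyadic splittings with `u v ≤ Q`. -/
def carlesonAux (Q u v : ℝ) : ℝ := 4 * v - 3 / u - u * v ^ 2 / Q ^ 2

/-- A concave correction of the geometric mean of `u` and `v`. -/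
def geomAux (Q u v : ℝ) : ℝ := √(u * v / Q) - u * v / (4 * Q)

/-- The bilinear part of the Bellman function, a supremum of affine functions. -/
def bilinSup (K u v a b : ℝ) : ℝ :=
  ⨆ p : NNReal × NNReal,
    (2 * (p.1 : ℝ) * a + 2 * (p.2 : ℝ) * b - (p.1 : ℝ) ^ 2 * v - (p.2 : ℝ) ^ 2 * u
      - 2 * K * p.1 * p.2)

/-- The Bellman function of the bilinear embedding. -/
def bellman {E : Type*} [NormedAddCommGroup E] (Q X Y : ℝ) (x y : E) (u v : ℝ) : ℝ :=
  Q * ((X - ‖x‖ ^ 2 / v) + (Y - ‖y‖ ^ 2 / u)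
    + 75 * (X - ‖x‖ ^ 2 / (v + carlesonAux Q u v))
    + 75 * (Y - ‖y‖ ^ 2 / (u + carlesonAux Q v u))
    + 8 * (X + Y - bilinSup (geomAux Q u v) u v ‖x‖ ‖y‖))

lemma two_mul_sub_le_sq_div {a z : ℝ} (l : ℝ) (hz : 0 < z) :
    2 * l * a - l ^ 2 * z ≤ a ^ 2 / z := by
  rw [le_div_iff₀ hz]
  nlinarith [sq_nonneg (a - l * z)]

lemma sq_div_add_gap_le {a a₁ a₂ z z₁ z₂ g : ℝ} (ha0 : 0 ≤ a) (ha : a ≤ (a₁ + a₂) / 2)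
    (hz₁ : 0 < z₁) (hz₂ : 0 < z₂) (hg : 0 ≤ g) (hz : g ≤ z - (z₁ + z₂) / 2) :
    a ^ 2 / z + g * (a / z) ^ 2 ≤ (a₁ ^ 2 / z₁ + a₂ ^ 2 / z₂) / 2 := by
  have hzp : 0 < z := by linarith
  have h₁ := two_mul_sub_le_sq_div (a := a₁) (a / z) hz₁
  have h₂ := two_mul_sub_le_sq_div (a := a₂) (a / z) hz₂
  have h₃ : a / z * a ≤ a / z * ((a₁ + a₂) / 2) :=
    mul_le_mul_of_nonneg_left ha (by positivity)
  have h₄ : g * (a / z) ^ 2 ≤ (z - (z₁ + z₂) / 2) * (a / z) ^ 2 :=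
    mul_le_mul_of_nonneg_right hz (by positivity)
  have h₅ : z * (a / z) ^ 2 = a ^ 2 / z := by field_simp
  have h₆ : a / z * a = a ^ 2 / z := by ring
  nlinarith

lemma norm_sq_div_gap {E : Type*} [NormedAddCommGroup E] [InnerProductSpace ℝ E]
    (x s : E) {v e : ℝ} (h₁ : 0 < v + e) (h₂ : 0 < v - e) :
    ‖x‖ ^ 2 / v + ‖s - (e / v) • x‖ ^ 2 / v ≤
      (‖x + s‖ ^ 2 / (v + e) + ‖x - s‖ ^ 2 / (v - e)) / 2 := by
  have hv : 0 < v := by linarith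
  obtain ⟨p, rfl⟩ : ∃ p : E, x = v • p := ⟨v⁻¹ • x, by rw [smul_smul, mul_inv_cancel₀ hv.ne', one_smul]⟩
  obtain ⟨r, rfl⟩ : ∃ r : E, s = r + e • p := ⟨s - e • p, by simp⟩
  have e₁ : r + e • p - (e / v) • v • p = r := by
    rw [smul_smul, div_mul_cancel₀ _ hv.ne']; simp
  have e₂ : v • p + (r + e • p) = (v + e) • p + r := by rw [add_smul]; abel
  have e₃ : v • p - (r + e • p) = (v - e) • p - r := by rw [sub_smul]; abel
  rw [e₁, e₂, e₃, norm_add_sq_real, norm_sub_sq_real, norm_smul, norm_smul, norm_smul,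
    inner_smul_left, inner_smul_left]
  simp only [Real.norm_eq_abs, mul_pow, sq_abs, conj_trivial]
  have key : ‖r‖ ^ 2 / v ≤ (‖r‖ ^ 2 / (v + e) + ‖r‖ ^ 2 / (v - e)) / 2 := by
    have := sq_div_add_gap_le (a := ‖r‖) (a₁ := ‖r‖) (a₂ := ‖r‖) (z := v) (g := 0)
      (norm_nonneg r) (by linarith) h₁ h₂ le_rfl (by linarith)
    linarith
  have t₁ : ((v + e) ^ 2 * ‖p‖ ^ 2 + 2 * ((v + e) * inner ℝ p r) + ‖r‖ ^ 2) / (v + e)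
      = (v + e) * ‖p‖ ^ 2 + 2 * inner ℝ p r + ‖r‖ ^ 2 / (v + e) := by field_simp
  have t₂ : ((v - e) ^ 2 * ‖p‖ ^ 2 - 2 * ((v - e) * inner ℝ p r) + ‖r‖ ^ 2) / (v - e)
      = (v - e) * ‖p‖ ^ 2 - 2 * inner ℝ p r + ‖r‖ ^ 2 / (v - e) := by field_simp
  have t₃ : v ^ 2 * ‖p‖ ^ 2 / v = v * ‖p‖ ^ 2 := by field_simp
  rw [t₁, t₂, t₃]
  linarith

lemma carlesonAux_nonneg {Q u v : ℝ} (hu : 0 < u) (hv : 0 < v) (h1 : 1 ≤ u * v)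
    (hQ : u * v ≤ Q) : 0 ≤ carlesonAux Q u v := by
  have hQ1 : 1 ≤ Q := h1.trans hQ
  have a₁ : 3 / u ≤ 3 * v := by rw [div_le_iff₀ hu]; linarith
  have a₂ : u * v ^ 2 / Q ^ 2 ≤ v := by
    rw [div_le_iff₀ (by positivity)]
    have : u * v ≤ Q ^ 2 := by nlinarith
    nlinarith
  unfold carlesonAux; linarith

lemma carlesonAux_le {Q u v : ℝ} (hu : 0 < u) : carlesonAux Q u v ≤ 4 * v := by
  have : 0 ≤ 3 / u := by positivity
  have : 0 ≤ u * v ^ 2 / Q ^ 2 := by positivity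
  unfold carlesonAux; linarith

lemma carlesonAux_gap {Q u v d e : ℝ} (hu₁ : 0 < u + d) (hu₂ : 0 < u - d) (hv : 0 < v)
    (hQ : u * v ≤ Q) :
    u * e ^ 2 / (2 * Q ^ 2) + d ^ 2 / u ^ 3 ≤
      carlesonAux Q u v
        - (carlesonAux Q (u + d) (v + e) + carlesonAux Q (u - d) (v - e)) / 2 := by
  have hu : 0 < u := by linarith
  have hQ0 : 0 < Q := (mul_pos hu hv).trans_le hQ
  have g₁ : d ^ 2 / u ^ 3 ≤ (1 / (u + d) + 1 / (u - d)) / 2 - 1 / u := by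
    have : (1 / (u + d) + 1 / (u - d)) / 2 - 1 / u = d ^ 2 / (u * ((u + d) * (u - d))) := by
      field_simp; ring
    rw [this]
    apply div_le_div_of_nonneg_left (sq_nonneg d) (by positivity)
    nlinarith [sq_nonneg d]
  have g₂ : -(u * e ^ 2 / 2 + 2 * v ^ 2 * d ^ 2 / u) ≤ 2 * v * d * e := by
    have : u * e ^ 2 / 2 + 2 * v ^ 2 * d ^ 2 / u + 2 * v * d * e
      = (u * e + 2 * v * d) ^ 2 / (2 * u) := by field_simp; ring
    have : 0 ≤ (u * e + 2 * v * d) ^ 2 / (2 * u) := by positivity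
    linarith
  have g₃ : (2 * v ^ 2 * d ^ 2 / u) / Q ^ 2 ≤ 2 * (d ^ 2 / u ^ 3) := by
    rw [div_div, div_le_iff₀ (by positivity)]
    have h : (u * v) ^ 2 ≤ Q ^ 2 := by gcongr
    have : 2 * (d ^ 2 / u ^ 3) * (u * Q ^ 2) = 2 * d ^ 2 * (Q ^ 2 / u ^ 2) := by field_simp
    rw [this]
    have : v ^ 2 ≤ Q ^ 2 / u ^ 2 := by
      rw [le_div_iff₀ (by positivity)]; linarith [mul_pow u v 2]
    nlinarith [sq_nonneg d]
  have g₄ := div_le_div_of_nonneg_right g₂ (sq_nonneg Q)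
  have E : carlesonAux Q u v
        - (carlesonAux Q (u + d) (v + e) + carlesonAux Q (u - d) (v - e)) / 2
      = 3 * ((1 / (u + d) + 1 / (u - d)) / 2 - 1 / u)
        + (u * e ^ 2) / Q ^ 2 + (2 * v * d * e) / Q ^ 2 := by
    unfold carlesonAux; field_simp; ring
  rw [E]
  have : -(u * e ^ 2 / 2 + 2 * v ^ 2 * d ^ 2 / u) / Q ^ 2
    = -(u * e ^ 2 / (2 * Q ^ 2)) - (2 * v ^ 2 * d ^ 2 / u) / Q ^ 2 := by field_simp; ring
  have : u * e ^ 2 / Q ^ 2 = 2 * (u * e ^ 2 / (2 * Q ^ 2)) := by field_simp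
  linarith

lemma geomAux_nonneg {Q u v : ℝ} (hu : 0 < u) (hv : 0 < v) (hQ : u * v ≤ Q) :
    0 ≤ geomAux Q u v := by
  have hQ0 : 0 < Q := (mul_pos hu hv).trans_le hQ
  have h1 : u * v / Q ≤ 1 := by rwa [div_le_one hQ0]
  have h0 : 0 ≤ u * v / Q := by positivity
  have : u * v / (4 * Q) = (u * v / Q) / 4 := by field_simp
  have : u * v / Q ≤ √(u * v / Q) := by
    apply Real.le_sqrt_of_sq_le; nlinarith
  unfold geomAux; linarith

lemma geomAux_lt_sqrt {Q u v : ℝ} (hu : 0 < u) (hv : 0 < v) (hQ : 0 < Q) :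
    geomAux Q u v < √(u * v / Q) := by
  have : 0 < u * v / (4 * Q) := by positivity
  unfold geomAux; linarith

lemma geomAux_le_one {Q u v : ℝ} (hu : 0 < u) (hv : 0 < v) (hQ : u * v ≤ Q) :
    geomAux Q u v ≤ 1 := by
  have hQ0 : 0 < Q := (mul_pos hu hv).trans_le hQ
  refine (geomAux_lt_sqrt hu hv hQ0).le.trans (Real.sqrt_le_one.2 ?_)
  rwa [div_le_one hQ0]

lemma geomAux_sq_lt {Q u v : ℝ} (hu : 0 < u) (hv : 0 < v) (h1 : 1 ≤ u * v)
    (hQ : u * v ≤ Q) : geomAux Q u v ^ 2 < u * v := by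
  have hQ1 : 1 ≤ Q := h1.trans hQ
  have h := geomAux_lt_sqrt hu hv (by linarith : 0 < Q)
  calc geomAux Q u v ^ 2 < √(u * v / Q) ^ 2 :=
        pow_lt_pow_left₀ h (geomAux_nonneg hu hv hQ) two_ne_zero
    _ = u * v / Q := Real.sq_sqrt (by positivity)
    _ ≤ u * v := div_le_self (by positivity) hQ1

lemma geomAux_gap {Q u v d e : ℝ} (hu₁ : 0 < u + d) (hu₂ : 0 < u - d)
    (hv₁ : 0 < v + e) (hv₂ : 0 < v - e) (hQ : u * v ≤ Q) :
    |d| * |e| / (4 * Q) ≤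
      geomAux Q u v - (geomAux Q (u + d) (v + e) + geomAux Q (u - d) (v - e)) / 2 := by
  have hu : 0 < u := by linarith
  have hv : 0 < v := by linarith
  have hQ0 : 0 < Q := (mul_pos hu hv).trans_le hQ
  set S := √(u * v / Q)
  set S₁ := √((u + d) * (v + e) / Q)
  set S₂ := √((u - d) * (v - e) / Q)
  have s0 : 0 < S := Real.sqrt_pos.2 (by positivity)
  have s1 : S ≤ 1 := Real.sqrt_le_one.2 (by rwa [div_le_one hQ0])
  have q : S ^ 2 = u * v / Q := Real.sq_sqrt (by positivity)
  have q₁ : S₁ ^ 2 = (u + d) * (v + e) / Q := Real.sq_sqrt (by positivity)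
  have q₂ : S₂ ^ 2 = (u - d) * (v - e) / Q := Real.sq_sqrt (by positivity)
  have E : geomAux Q u v - (geomAux Q (u + d) (v + e) + geomAux Q (u - d) (v - e)) / 2
      = S - (S₁ + S₂) / 2 + d * e / (4 * Q) := by
    simp only [geomAux, S, S₁, S₂]; field_simp; ring
  rw [E, ← abs_mul]
  have hde : d * e / Q = (S₁ ^ 2 + S₂ ^ 2) / 2 - S ^ 2 := by rw [q, q₁, q₂]; field_simp; ring
  have hS₁ : 0 ≤ S₁ := Real.sqrt_nonneg _
  have hS₂ : 0 ≤ S₂ := Real.sqrt_nonneg _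
  have hdiv : d * e / (4 * Q) = d * e / Q / 4 := by field_simp
  rcases le_total 0 (d * e) with h | h
  · rw [abs_of_nonneg h]
    have hprod : S₁ * S₂ ≤ S ^ 2 - d * e / Q := by
      have hue : |d * e| ≤ u * v := by
        rw [abs_mul]
        exact mul_le_mul (abs_le.2 ⟨by linarith, by linarith⟩) (abs_le.2 ⟨by linarith, by linarith⟩)
          (abs_nonneg e) hu.le
      have hE : S ^ 2 - d * e / Q = (u * v - d * e) / Q := by rw [q]; ring
      have h0 : 0 ≤ (u * v - d * e) / Q := div_nonneg (by linarith [le_abs_self (d * e)]) hQ0.le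
      rw [hE]
      refine le_of_sq_le_sq ?_ h0
      rw [mul_pow, q₁, q₂, div_pow, div_mul_div_comm, ← sq]
      gcongr
      nlinarith [sq_nonneg (u * e - v * d)]
    have : (S₁ + S₂) / 2 ≤ S := le_of_sq_le_sq (by nlinarith) s0.le
    linarith
  · rw [abs_of_nonpos h]
    have hneg : -(d * e) / (4 * Q) = -(d * e / Q / 4) := by rw [neg_div, hdiv]
    have h2 : ((S₁ + S₂) / 2) ^ 2 ≤ S ^ 2 + d * e / Q := by nlinarith [sq_nonneg (S₁ - S₂)]
    have h' : d * e / Q ≤ 0 := div_nonpos_of_nonpos_of_nonneg h hQ0.le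
    rw [hneg, hdiv]
    generalize d * e / Q = t at *
    have : (S₁ + S₂) / 2 ≤ S + t / 2 :=
      le_of_sq_le_sq (by nlinarith [sq_nonneg t]) (by nlinarith [sq_nonneg ((S₁ + S₂) / 2)])
    linarith

lemma norm_le_half_add_sub {E : Type*} [NormedAddCommGroup E] [NormedSpace ℝ E] (x s : E) :
    ‖x‖ ≤ (‖x + s‖ + ‖x - s‖) / 2 := by
  have h := norm_add_le (x + s) (x - s)
  rw [show x + s + (x - s) = (2 : ℝ) • x by rw [two_smul]; abel, norm_smul,
    Real.norm_of_nonneg zero_le_two] at h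
  linarith

lemma bilinSup_bddAbove {K u v : ℝ} (a b : ℝ) (hu : 0 < u) (hv : 0 < v) (hK : 0 ≤ K) :
    BddAbove (Set.range fun p : NNReal × NNReal =>
      2 * (p.1 : ℝ) * a + 2 * (p.2 : ℝ) * b - (p.1 : ℝ) ^ 2 * v - (p.2 : ℝ) ^ 2 * u
      - 2 * K * p.1 * p.2) := by
  refine ⟨a ^ 2 / v + b ^ 2 / u, ?_⟩
  rintro _ ⟨⟨l, m⟩, rfl⟩
  have h₁ := two_mul_sub_le_sq_div (a := a) l hv
  have h₂ := two_mul_sub_le_sq_div (a := b) m hu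
  have : 0 ≤ 2 * K * l * m := by positivity
  dsimp only
  linarith

lemma bilinSup_le {K u v : ℝ} (a b : ℝ) (hu : 0 < u) (hv : 0 < v) (hK : 0 ≤ K) :
    bilinSup K u v a b ≤ a ^ 2 / v + b ^ 2 / u := by
  refine ciSup_le ?_
  rintro ⟨l, m⟩
  have h₁ := two_mul_sub_le_sq_div (a := a) l hv
  have h₂ := two_mul_sub_le_sq_div (a := b) m hu
  have : 0 ≤ 2 * K * l * m := by positivity
  dsimp only
  linarith

lemma le_bilinSup {K u v : ℝ} (a b : ℝ) (hu : 0 < u) (hv : 0 < v) (hK : 0 ≤ K)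
    {l m : ℝ} (hl : 0 ≤ l) (hm : 0 ≤ m) :
    2 * l * a + 2 * m * b - l ^ 2 * v - m ^ 2 * u - 2 * K * l * m ≤ bilinSup K u v a b :=
  le_ciSup (bilinSup_bddAbove a b hu hv hK) (⟨l, hl⟩, ⟨m, hm⟩)

/-- Midpoint convexity of `bilinSup` along one affine piece, with the gain coming from `K`. -/
lemma affine_add_gap_le_bilinSup {K K₁ K₂ u v d e a a₁ a₂ b b₁ b₂ g l m : ℝ}
    (hu₁ : 0 < u + d) (hu₂ : 0 < u - d) (hv₁ : 0 < v + e) (hv₂ : 0 < v - e)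
    (hK₁ : 0 ≤ K₁) (hK₂ : 0 ≤ K₂) (hg : g ≤ K - (K₁ + K₂) / 2)
    (ha : a ≤ (a₁ + a₂) / 2) (hb : b ≤ (b₁ + b₂) / 2) (hl : 0 ≤ l) (hm : 0 ≤ m) :
    2 * l * a + 2 * m * b - l ^ 2 * v - m ^ 2 * u - 2 * K * l * m + 2 * g * (l * m) ≤
      (bilinSup K₁ (u + d) (v + e) a₁ b₁ + bilinSup K₂ (u - d) (v - e) a₂ b₂) / 2 := by
  have h₁ := le_bilinSup a₁ b₁ hu₁ hv₁ hK₁ hl hm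
  have h₂ := le_bilinSup a₂ b₂ hu₂ hv₂ hK₂ hl hm
  have h₃ := mul_le_mul_of_nonneg_left ha hl
  have h₄ := mul_le_mul_of_nonneg_left hb hm
  have h₅ := mul_le_mul_of_nonneg_right hg (mul_nonneg hl hm)
  linarith

lemma bilinSup_convex {K K₁ K₂ u v d e a a₁ a₂ b b₁ b₂ : ℝ}
    (hu₁ : 0 < u + d) (hu₂ : 0 < u - d) (hv₁ : 0 < v + e) (hv₂ : 0 < v - e)
    (hK₁ : 0 ≤ K₁) (hK₂ : 0 ≤ K₂) (hg : 0 ≤ K - (K₁ + K₂) / 2)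
    (ha : a ≤ (a₁ + a₂) / 2) (hb : b ≤ (b₁ + b₂) / 2) :
    bilinSup K u v a b ≤
      (bilinSup K₁ (u + d) (v + e) a₁ b₁ + bilinSup K₂ (u - d) (v - e) a₂ b₂) / 2 := by
  refine ciSup_le ?_
  rintro ⟨l, m⟩
  have := affine_add_gap_le_bilinSup hu₁ hu₂ hv₁ hv₂ hK₁ hK₂ hg ha hb l.2 m.2
  simpa using this

/-- If the maximizer of the quadratic form lies well inside the quadrant, the gain is
comparable to the product of the weighted averages. -/
lemma bilinSup_add_gap_le {K K₁ K₂ u v d e a a₁ a₂ b b₁ b₂ g : ℝ}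
    (hu₁ : 0 < u + d) (hu₂ : 0 < u - d) (hv₁ : 0 < v + e) (hv₂ : 0 < v - e)
    (hK₁ : 0 ≤ K₁) (hK₂ : 0 ≤ K₂) (hg0 : 0 ≤ g) (hg : g ≤ K - (K₁ + K₂) / 2)
    (ha0 : 0 ≤ a) (hb0 : 0 ≤ b)
    (ha : a ≤ (a₁ + a₂) / 2) (hb : b ≤ (b₁ + b₂) / 2)
    (hK : K ^ 2 < u * v) (hab : 2 * b * K ≤ a * u) (hba : 2 * a * K ≤ b * v) :
    bilinSup K u v a b + g * (a / v * (b / u)) / 2 ≤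
      (bilinSup K₁ (u + d) (v + e) a₁ b₁ + bilinSup K₂ (u - d) (v - e) a₂ b₂) / 2 := by
  have hu : 0 < u := by linarith
  have hv : 0 < v := by linarith
  have hD : 0 < u * v - K ^ 2 := by linarith
  set l := (a * u - b * K) / (u * v - K ^ 2)
  set m := (b * v - a * K) / (u * v - K ^ 2)
  have hl' : a / v / 2 ≤ l := by
    rw [div_div, div_le_div_iff₀ (by positivity) hD]
    nlinarith [mul_nonneg ha0 (sq_nonneg K)]
  have hm' : b / u / 2 ≤ m := by
    rw [div_div, div_le_div_iff₀ (by positivity) hD]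
    nlinarith [mul_nonneg hb0 (sq_nonneg K)]
  have hl : 0 ≤ l := le_trans (by positivity) hl'
  have hm : 0 ≤ m := le_trans (by positivity) hm'
  have lD : l * (u * v - K ^ 2) = a * u - b * K := div_mul_cancel₀ _ hD.ne'
  have mD : m * (u * v - K ^ 2) = b * v - a * K := div_mul_cancel₀ _ hD.ne'
  have el : l * v + K * m = a :=
    mul_right_cancel₀ hD.ne' (by linear_combination v * lD + K * mD)
  have em : m * u + K * l = b :=
    mul_right_cancel₀ hD.ne' (by linear_combination u * mD + K * lD)
  have hgain := affine_add_gap_le_bilinSup hu₁ hu₂ hv₁ hv₂ hK₁ hK₂ hg ha hb hl hm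
  have hmax : bilinSup K u v a b ≤
      2 * l * a + 2 * m * b - l ^ 2 * v - m ^ 2 * u - 2 * K * l * m := by
    refine ciSup_le ?_
    rintro ⟨s, t⟩
    dsimp only
    have hpos : 0 ≤ (l - (s : ℝ)) ^ 2 * v + (m - t) ^ 2 * u + 2 * K * (l - s) * (m - t) := by
      have : 0 ≤ v * ((l - s) ^ 2 * v + (m - t) ^ 2 * u + 2 * K * (l - s) * (m - t)) := by
        nlinarith [sq_nonneg (v * (l - s) + K * (m - t)), mul_nonneg hD.le (sq_nonneg (m - t))]
      exact nonneg_of_mul_nonneg_right this hv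
    rw [← el, ← em]
    nlinarith
  have hlm : a / v / 2 * (b / u / 2) ≤ l * m := mul_le_mul hl' hm' (by positivity) hl
  have := mul_le_mul_of_nonneg_left hlm hg0
  linarith

lemma bellman_le {E : Type*} [NormedAddCommGroup E] {Q X Y u v : ℝ} (x y : E)
    (hu : 0 < u) (hv : 0 < v) (h1 : 1 ≤ u * v) (hQ : u * v ≤ Q) :
    bellman Q X Y x y u v ≤ 84 * Q * (X + Y) := by
  have hQ1 : 1 ≤ Q := h1.trans hQ
  have c₁ := carlesonAux_nonneg hu hv h1 hQ
  have c₂ := carlesonAux_nonneg hv hu (by linarith) (by linarith : v * u ≤ Q)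
  have t₁ : 0 ≤ ‖x‖ ^ 2 / v := by positivity
  have t₂ : 0 ≤ ‖y‖ ^ 2 / u := by positivity
  have t₃ : 0 ≤ ‖x‖ ^ 2 / (v + carlesonAux Q u v) := by positivity
  have t₄ : 0 ≤ ‖y‖ ^ 2 / (u + carlesonAux Q v u) := by positivity
  have t₅ := le_bilinSup ‖x‖ ‖y‖ hu hv (geomAux_nonneg hu hv hQ) le_rfl le_rfl
  have : 84 * Q * (X + Y) = Q * (84 * (X + Y)) := by ring
  rw [this, bellman]
  refine mul_le_mul_of_nonneg_left ?_ (by linarith)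
  linarith

lemma bellman_nonneg {E : Type*} [NormedAddCommGroup E] {Q X Y u v : ℝ} {x y : E}
    (hu : 0 < u) (hv : 0 < v) (h1 : 1 ≤ u * v) (hQ : u * v ≤ Q)
    (hx : ‖x‖ ^ 2 / v ≤ X) (hy : ‖y‖ ^ 2 / u ≤ Y) :
    0 ≤ bellman Q X Y x y u v := by
  have hQ1 : 1 ≤ Q := h1.trans hQ
  have c₁ := carlesonAux_nonneg hu hv h1 hQ
  have c₂ := carlesonAux_nonneg hv hu (by linarith) (by linarith : v * u ≤ Q)
  have t₃ : ‖x‖ ^ 2 / (v + carlesonAux Q u v) ≤ ‖x‖ ^ 2 / v := by gcongr; linarith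
  have t₄ : ‖y‖ ^ 2 / (u + carlesonAux Q v u) ≤ ‖y‖ ^ 2 / u := by gcongr; linarith
  have t₅ := bilinSup_le ‖x‖ ‖y‖ hu hv (geomAux_nonneg hu hv hQ)
  rw [bellman]
  refine mul_nonneg (by linarith) ?_
  linarith

/-- The Carleson embedding gain for one of the two functions. -/
lemma carleson_gain {E : Type*} [NormedAddCommGroup E] [InnerProductSpace ℝ E]
    {Q u v d e : ℝ} (x s : E)
    (hu₁ : 0 < u + d) (hu₂ : 0 < u - d) (hv₁ : 0 < v + e) (hv₂ : 0 < v - e)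
    (h1 : 1 ≤ u * v) (hQ : u * v ≤ Q)
    (h1₁ : 1 ≤ (u + d) * (v + e)) (hQ₁ : (u + d) * (v + e) ≤ Q)
    (h1₂ : 1 ≤ (u - d) * (v - e)) (hQ₂ : (u - d) * (v - e) ≤ Q) :
    (u * e ^ 2 / (2 * Q ^ 2) + d ^ 2 / u ^ 3) * (‖x‖ / v) ^ 2 / 25 ≤
      (‖x + s‖ ^ 2 / (v + e + carlesonAux Q (u + d) (v + e))
        + ‖x - s‖ ^ 2 / (v - e + carlesonAux Q (u - d) (v - e))) / 2
      - ‖x‖ ^ 2 / (v + carlesonAux Q u v) := by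
  have hu : 0 < u := by linarith
  have hv : 0 < v := by linarith
  have hQ1 : 1 ≤ Q := h1.trans hQ
  have c := carlesonAux_nonneg hu hv h1 hQ
  have c₁ := carlesonAux_nonneg hu₁ hv₁ h1₁ hQ₁
  have c₂ := carlesonAux_nonneg hu₂ hv₂ h1₂ hQ₂
  have cle := carlesonAux_le (Q := Q) (v := v) hu
  have gap := carlesonAux_gap (e := e) hu₁ hu₂ hv hQ
  have g0 : 0 ≤ u * e ^ 2 / (2 * Q ^ 2) + d ^ 2 / u ^ 3 := by positivity
  have := sq_div_add_gap_le (z := v + carlesonAux Q u v)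
    (z₁ := v + e + carlesonAux Q (u + d) (v + e)) (z₂ := v - e + carlesonAux Q (u - d) (v - e))
    (norm_nonneg x) (norm_le_half_add_sub x s) (by linarith) (by linarith) g0 (by linarith)
  have hr : ‖x‖ / v / 5 ≤ ‖x‖ / (v + carlesonAux Q u v) := by
    rw [div_div]; gcongr; linarith
  have hr2 := mul_le_mul_of_nonneg_left
    (pow_le_pow_left₀ (by positivity : 0 ≤ ‖x‖ / v / 5) hr 2) g0
  nlinarith

lemma mul_le_half_add_of_sq_le {a b A B : ℝ} (hA : 0 ≤ A) (hB : 0 ≤ B)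
    (h : (a * b) ^ 2 ≤ A * B) : a * b ≤ (A + B) / 2 :=
  le_of_sq_le_sq (by nlinarith [sq_nonneg (A - B)]) (by linarith)

set_option maxHeartbeats 1000000 in
/-- One dyadic step of the Bellman induction. -/
lemma bellman_step {E : Type*} [NormedAddCommGroup E] [InnerProductSpace ℝ E]
    {Q X₁ X₂ Y₁ Y₂ u v d e : ℝ} (x s y t : E)
    (hu₁ : 0 < u + d) (hu₂ : 0 < u - d) (hv₁ : 0 < v + e) (hv₂ : 0 < v - e)
    (h1 : 1 ≤ u * v) (hQ : u * v ≤ Q)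
    (h1₁ : 1 ≤ (u + d) * (v + e)) (hQ₁ : (u + d) * (v + e) ≤ Q)
    (h1₂ : 1 ≤ (u - d) * (v - e)) (hQ₂ : (u - d) * (v - e) ≤ Q) :
    ‖s‖ * ‖t‖ + (bellman Q X₁ Y₁ (x + s) (y + t) (u + d) (v + e)
        + bellman Q X₂ Y₂ (x - s) (y - t) (u - d) (v - e)) / 2
      ≤ bellman Q ((X₁ + X₂) / 2) ((Y₁ + Y₂) / 2) x y u v := by
  have hu : 0 < u := by linarith
  have hv : 0 < v := by linarith
  have hQ1 : 1 ≤ Q := h1.trans hQ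
  have hQ0 : 0 < Q := by linarith
  have gx := norm_sq_div_gap x s hv₁ hv₂
  have gy := norm_sq_div_gap y t hu₁ hu₂
  have cx := carleson_gain x s hu₁ hu₂ hv₁ hv₂ h1 hQ h1₁ hQ₁ h1₂ hQ₂
  have cy := carleson_gain (Q := Q) y t hv₁ hv₂ hu₁ hu₂ (by linarith) (by linarith)
    (by linarith) (by linarith) (by linarith) (by linarith)
  have k₁ := geomAux_nonneg hu₁ hv₁ hQ₁
  have k₂ := geomAux_nonneg hu₂ hv₂ hQ₂
  have kg := geomAux_gap hu₁ hu₂ hv₁ hv₂ hQ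
  have kg0 : 0 ≤ |d| * |e| / (4 * Q) := by positivity
  have bc := bilinSup_convex hu₁ hu₂ hv₁ hv₂ k₁ k₂ (kg0.trans kg)
    (norm_le_half_add_sub x s) (norm_le_half_add_sub y t)
  have bg := bilinSup_add_gap_le hu₁ hu₂ hv₁ hv₂ k₁ k₂ kg0 kg (norm_nonneg x) (norm_nonneg y)
    (norm_le_half_add_sub x s) (norm_le_half_add_sub y t) (geomAux_sq_lt hu hv h1 hQ)
  have kle := geomAux_le_one hu hv hQ
  have hs : ‖s‖ ≤ ‖s - (e / v) • x‖ + ‖x‖ / v * |e| := by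
    have := norm_le_norm_sub_add s ((e / v) • x)
    rwa [norm_smul, norm_div, Real.norm_eq_abs, Real.norm_of_nonneg hv.le,
      show |e| / v * ‖x‖ = ‖x‖ / v * |e| by ring] at this
  have ht : ‖t‖ ≤ ‖t - (d / u) • y‖ + ‖y‖ / u * |d| := by
    have := norm_le_norm_sub_add t ((d / u) • y)
    rwa [norm_smul, norm_div, Real.norm_eq_abs, Real.norm_of_nonneg hu.le,
      show |d| / u * ‖y‖ = ‖y‖ / u * |d| by ring] at this
  set r := ‖s - (e / v) • x‖
  set r' := ‖t - (d / u) • y‖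
  set p := ‖x‖ / v with hp
  set q := ‖y‖ / u with hq
  have hr0 : 0 ≤ r := norm_nonneg _
  have hr0' : 0 ≤ r' := norm_nonneg _
  have hp0 : 0 ≤ p := by positivity
  have hq0 : 0 ≤ q := by positivity
  have hst : ‖s‖ * ‖t‖ ≤ r * r' + (p * |e|) * r' + r * (q * |d|) + p * q * (|d| * |e|) := by
    have := mul_le_mul hs ht (norm_nonneg t) (by positivity)
    linarith
  set A := (u * e ^ 2 / (2 * Q ^ 2) + d ^ 2 / u ^ 3) * p ^ 2 with hA
  set A' := (v * d ^ 2 / (2 * Q ^ 2) + e ^ 2 / v ^ 3) * q ^ 2 with hA'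
  have hA0 : 0 ≤ A := by positivity
  have hA0' : 0 ≤ A' := by positivity
  have T₁ : r * r' ≤ (Q * (r ^ 2 / v) + Q * (r' ^ 2 / u)) / 2 := by
    apply mul_le_half_add_of_sq_le (by positivity) (by positivity)
    have : Q * (r ^ 2 / v) * (Q * (r' ^ 2 / u)) = (r * r') ^ 2 * (Q ^ 2 / (u * v)) := by
      field_simp
    rw [this]
    refine le_mul_of_one_le_right (by positivity) ?_
    rw [one_le_div (by positivity)]
    exact hQ.trans (le_self_pow₀ hQ1 two_ne_zero)
  have T₂ : (p * |e|) * r' ≤ (2 * (Q * A) + Q * (r' ^ 2 / u)) / 2 := by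
    apply mul_le_half_add_of_sq_le (by positivity) (by positivity)
    have h : (u * e ^ 2 / (2 * Q ^ 2)) * p ^ 2 ≤ A := by
      rw [hA]; gcongr; exact le_add_of_nonneg_right (by positivity)
    calc (p * |e| * r') ^ 2
        = 2 * (Q * ((u * e ^ 2 / (2 * Q ^ 2)) * p ^ 2)) * (Q * (r' ^ 2 / u)) := by
          rw [mul_pow, mul_pow, sq_abs]; field_simp
      _ ≤ _ := by gcongr
  have T₃ : r * (q * |d|) ≤ (Q * (r ^ 2 / v) + 2 * (Q * A')) / 2 := by
    apply mul_le_half_add_of_sq_le (by positivity) (by positivity)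
    have h : (v * d ^ 2 / (2 * Q ^ 2)) * q ^ 2 ≤ A' := by
      rw [hA']; gcongr; exact le_add_of_nonneg_right (by positivity)
    calc (r * (q * |d|)) ^ 2
        = (Q * (r ^ 2 / v)) * (2 * (Q * ((v * d ^ 2 / (2 * Q ^ 2)) * q ^ 2))) := by
          rw [mul_pow, mul_pow, sq_abs]; field_simp
      _ ≤ _ := by gcongr
  have hxv : ‖x‖ = p * v := by rw [hp]; field_simp
  have hyu : ‖y‖ = q * u := by rw [hq]; field_simp
  have D : 2 * (|d| * |e|) / u ≤ 2 * Q * (u * e ^ 2 / (2 * Q ^ 2) + d ^ 2 / u ^ 3) := by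
    have : 2 * Q * (u * e ^ 2 / (2 * Q ^ 2) + d ^ 2 / u ^ 3) - 2 * (|d| * |e|) / u
        = ((u ^ 2 * |e| - Q * |d|) ^ 2 + Q ^ 2 * |d| ^ 2) / (u ^ 3 * Q) := by
      rw [← sq_abs d, ← sq_abs e]; field_simp; ring
    have : 0 ≤ ((u ^ 2 * |e| - Q * |d|) ^ 2 + Q ^ 2 * |d| ^ 2) / (u ^ 3 * Q) := by positivity
    linarith
  have D' : 2 * (|d| * |e|) / v ≤ 2 * Q * (v * d ^ 2 / (2 * Q ^ 2) + e ^ 2 / v ^ 3) := by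
    have : 2 * Q * (v * d ^ 2 / (2 * Q ^ 2) + e ^ 2 / v ^ 3) - 2 * (|d| * |e|) / v
        = ((v ^ 2 * |d| - Q * |e|) ^ 2 + Q ^ 2 * |e| ^ 2) / (v ^ 3 * Q) := by
      rw [← sq_abs d, ← sq_abs e]; field_simp; ring
    have : 0 ≤ ((v ^ 2 * |d| - Q * |e|) ^ 2 + Q ^ 2 * |e| ^ 2) / (v ^ 3 * Q) := by positivity
    linarith
  set G := (bilinSup (geomAux Q (u + d) (v + e)) (u + d) (v + e) ‖x + s‖ ‖y + t‖
    + bilinSup (geomAux Q (u - d) (v - e)) (u - d) (v - e) ‖x - s‖ ‖y - t‖) / 2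
    - bilinSup (geomAux Q u v) u v ‖x‖ ‖y‖ with hG
  have hG0 : 0 ≤ G := by linarith
  have T₄ : p * q * (|d| * |e|) ≤ 2 * (Q * A) + 2 * (Q * A') + 8 * (Q * G) := by
    have hde : 0 ≤ |d| * |e| := by positivity
    have hQA : 0 ≤ Q * A := by positivity
    have hQA' : 0 ≤ Q * A' := by positivity
    have hQG : 0 ≤ Q * G := by positivity
    by_cases c₁ : 2 * ‖y‖ * geomAux Q u v ≤ ‖x‖ * u
    · by_cases c₂ : 2 * ‖x‖ * geomAux Q u v ≤ ‖y‖ * v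
      · have h : |d| * |e| / (4 * Q) * (p * q) / 2 ≤ G := by
          have := bg c₁ c₂; linarith
        have : 8 * (Q * (|d| * |e| / (4 * Q) * (p * q) / 2)) = p * q * (|d| * |e|) := by
          field_simp; ring
        have := mul_le_mul_of_nonneg_left h hQ0.le
        linarith
      · have h : q * u ≤ 2 * p := by
          have : ‖y‖ * v ≤ 2 * ‖x‖ := by nlinarith [norm_nonneg x]
          rw [hxv, hyu] at this
          exact le_of_mul_le_mul_right (by linarith) hv
        have h' : q ≤ 2 * p / u := by rwa [le_div_iff₀ hu]
        calc p * q * (|d| * |e|) ≤ p * (2 * p / u) * (|d| * |e|) := by gcongr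
          _ = (2 * (|d| * |e|) / u) * p ^ 2 := by ring
          _ ≤ _ := mul_le_mul_of_nonneg_right D (sq_nonneg p)
          _ = 2 * (Q * A) := by ring
          _ ≤ _ := by linarith
    · have h : p * v ≤ 2 * q := by
        have : ‖x‖ * u ≤ 2 * ‖y‖ := by nlinarith [norm_nonneg y]
        rw [hxv, hyu] at this
        exact le_of_mul_le_mul_right (by linarith) hu
      have h' : p ≤ 2 * q / v := by rwa [le_div_iff₀ hv]
      calc p * q * (|d| * |e|) ≤ (2 * q / v) * q * (|d| * |e|) := by gcongr
        _ = (2 * (|d| * |e|) / v) * q ^ 2 := by ring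
        _ ≤ _ := mul_le_mul_of_nonneg_right D' (sq_nonneg q)
        _ = 2 * (Q * A') := by ring
        _ ≤ _ := by linarith
  have gx' := mul_le_mul_of_nonneg_left gx hQ0.le
  have gy' := mul_le_mul_of_nonneg_left gy hQ0.le
  have cx' := mul_le_mul_of_nonneg_left cx hQ0.le
  have cy' := mul_le_mul_of_nonneg_left cy hQ0.le
  rw [hG] at T₄
  simp only [bellman]
  linarith

lemma measurableSet_dyadicI (k m : ℤ) : MeasurableSet (dyadicI k m) := measurableSet_Ico

lemma two_zpow_pred (k : ℤ) : (2 : ℝ) ^ (k - 1) = 2 ^ k / 2 := by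
  rw [zpow_sub_one₀ two_ne_zero, div_eq_mul_inv]

lemma dyadicI_left (k m : ℤ) : dyadicI (k - 1) (2 * m) =
    Set.Ico ((2 : ℝ) ^ k * m) ((2 : ℝ) ^ k * (m + 1 / 2)) := by
  rw [dyadicI, two_zpow_pred]; push_cast; congr 1 <;> ring

lemma dyadicI_right (k m : ℤ) : dyadicI (k - 1) (2 * m + 1) =
    Set.Ico ((2 : ℝ) ^ k * (m + 1 / 2)) ((2 : ℝ) ^ k * (m + 1)) := by
  rw [dyadicI, two_zpow_pred]; push_cast; congr 1 <;> ring

lemma dyadicI_left_union_right (k m : ℤ) :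
    dyadicI (k - 1) (2 * m) ∪ dyadicI (k - 1) (2 * m + 1) = dyadicI k m := by
  have h : (0 : ℝ) < 2 ^ k := by positivity
  rw [dyadicI_left, dyadicI_right, dyadicI]
  exact Set.Ico_union_Ico_eq_Ico (by nlinarith) (by nlinarith)

lemma disjoint_dyadicI_left_right (k m : ℤ) :
    Disjoint (dyadicI (k - 1) (2 * m)) (dyadicI (k - 1) (2 * m + 1)) := by
  rw [dyadicI_left, dyadicI_right, Set.Ico_disjoint_Ico]
  exact (min_le_left _ _).trans (le_max_right _ _)

lemma dyadicI_left_subset (k m : ℤ) : dyadicI (k - 1) (2 * m) ⊆ dyadicI k m :=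
  dyadicI_left_union_right k m ▸ Set.subset_union_left

lemma dyadicI_right_subset (k m : ℤ) : dyadicI (k - 1) (2 * m + 1) ⊆ dyadicI k m :=
  dyadicI_left_union_right k m ▸ Set.subset_union_right

/-- The dyadic subintervals of generation `j` of the interval with position `m`. -/
def dyadicChildren (m : ℤ) (j : ℕ) : Finset ℤ := Finset.Ico (2 ^ j * m) (2 ^ j * (m + 1))

lemma dyadicI_subset_of_mem {k m : ℤ} {j : ℕ} {i : ℤ} (h : i ∈ dyadicChildren m j) :
    dyadicI (k - j) i ⊆ dyadicI k m := by
  rw [dyadicChildren, Finset.mem_Ico] at h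
  have hk : (2 : ℝ) ^ k = 2 ^ (k - j) * 2 ^ j := by
    rw [← zpow_natCast, ← zpow_add₀ two_ne_zero]; simp
  have h₁ : (2 : ℝ) ^ j * m ≤ i := by exact_mod_cast h.1
  have h₂ : (i : ℝ) + 1 ≤ 2 ^ j * (m + 1) := by exact_mod_cast h.2
  rw [dyadicI, dyadicI, hk, mul_assoc, mul_assoc]
  apply Set.Ico_subset_Ico <;> gcongr

lemma exists_mem_of_dyadicI_subset {k m k' i : ℤ} (h : dyadicI k' i ⊆ dyadicI k m) :
    ∃ j : ℕ, k' = k - j ∧ i ∈ dyadicChildren m j := by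
  have h' : (0 : ℝ) < 2 ^ k' := by positivity
  rw [dyadicI, dyadicI, Set.Ico_subset_Ico_iff (by nlinarith)] at h
  have hle : (2 : ℝ) ^ k' ≤ 2 ^ k := by linarith
  have hk := (zpow_le_zpow_iff_right₀ (one_lt_two : (1 : ℝ) < 2)).1 hle
  obtain ⟨j, rfl⟩ : ∃ j : ℕ, k' = k - j := ⟨(k - k').toNat, by omega⟩
  refine ⟨j, rfl, ?_⟩
  have hk : (2 : ℝ) ^ k = 2 ^ (k - j) * 2 ^ j := by
    rw [← zpow_natCast, ← zpow_add₀ two_ne_zero]; simp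
  rw [hk, mul_assoc, mul_assoc, mul_le_mul_iff_right₀ h', mul_le_mul_iff_right₀ h'] at h
  rw [dyadicChildren, Finset.mem_Ico]
  exact ⟨by exact_mod_cast h.1, by exact_mod_cast h.2⟩

lemma sum_Ico_two_mul (h : ℤ → ℝ) (a : ℤ) (n : ℕ) :
    ∑ i ∈ Finset.Ico (2 * a) (2 * (a + n)), h i
      = ∑ i ∈ Finset.Ico a (a + n), (h (2 * i) + h (2 * i + 1)) := by
  induction n with
  | zero => simp
  | succ n ih =>
    have e₁ : Finset.Ico a (a + (n + 1 : ℕ)) = insert (a + n) (Finset.Ico a (a + n)) := by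
      ext; simp only [Finset.mem_Ico, Finset.mem_insert]; push_cast; omega
    have e₂ : Finset.Ico (2 * a) (2 * (a + (n + 1 : ℕ)))
        = insert (2 * (a + n) + 1) (insert (2 * (a + n)) (Finset.Ico (2 * a) (2 * (a + n)))) := by
      ext; simp only [Finset.mem_Ico, Finset.mem_insert]; push_cast; omega
    rw [e₁, e₂, Finset.sum_insert (by simp), Finset.sum_insert (by simp),
      Finset.sum_insert (by simp), ih]
    ring

lemma sum_dyadicChildren_succ (h : ℤ → ℝ) (m : ℤ) (j : ℕ) :
    ∑ i ∈ dyadicChildren m (j + 1), h i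
      = ∑ i ∈ dyadicChildren m j, (h (2 * i) + h (2 * i + 1)) := by
  have := sum_Ico_two_mul h (2 ^ j * m) (2 ^ j)
  push_cast at this
  rw [dyadicChildren, dyadicChildren, mul_add, mul_add, mul_one, mul_one]
  convert this using 3 <;> ring

/-- Telescoping of a superharmonic function on the dyadic tree. -/
lemma sum_dyadicChildren_le {c W : ℤ → ℤ → ℝ} (k m : ℤ)
    (hstep : ∀ k' i, dyadicI k' i ⊆ dyadicI k m →
      c k' i + (W (k' - 1) (2 * i) + W (k' - 1) (2 * i + 1)) ≤ W k' i) (N : ℕ) :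
    ∑ j ∈ Finset.range N, ∑ i ∈ dyadicChildren m j, c (k - j) i
      + ∑ i ∈ dyadicChildren m N, W (k - N) i ≤ W k m := by
  induction N with
  | zero =>
    have : dyadicChildren m 0 = {m} := by
      ext; simp only [dyadicChildren, Finset.mem_Ico, Finset.mem_singleton]; omega
    simp [this]
  | succ N ih =>
    refine le_trans ?_ ih
    rw [Finset.sum_range_succ, sum_dyadicChildren_succ, add_assoc, ← Finset.sum_add_distrib]
    gcongr with i hi
    have := hstep _ _ (dyadicI_subset_of_mem (k := k) hi)
    rwa [sub_sub, ← Nat.cast_succ] at this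

lemma sum_le_of_superharmonic {c W : ℤ → ℤ → ℝ} (k m : ℤ) (hc : ∀ k' i, 0 ≤ c k' i)
    (hW : ∀ k' i, dyadicI k' i ⊆ dyadicI k m → 0 ≤ W k' i)
    (hstep : ∀ k' i, dyadicI k' i ⊆ dyadicI k m →
      c k' i + (W (k' - 1) (2 * i) + W (k' - 1) (2 * i + 1)) ≤ W k' i)
    (F : Finset (ℤ × ℤ)) (hF : ∀ I ∈ F, dyadicI I.1 I.2 ⊆ dyadicI k m) :
    ∑ I ∈ F, c I.1 I.2 ≤ W k m := by
  choose! j hj hmem using fun I hI => exists_mem_of_dyadicI_subset (hF I hI)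
  set N := F.sup j + 1
  have key := sum_dyadicChildren_le k m hstep N
  have hWN : 0 ≤ ∑ i ∈ dyadicChildren m N, W (k - N) i :=
    Finset.sum_nonneg fun i hi => hW _ _ (dyadicI_subset_of_mem hi)
  suffices h : ∑ I ∈ F, c I.1 I.2
      ≤ ∑ j ∈ Finset.range N, ∑ i ∈ dyadicChildren m j, c (k - j) i by linarith
  rw [Finset.sum_sigma']
  calc ∑ I ∈ F, c I.1 I.2
      = ∑ p ∈ F.image fun I => (⟨j I, I.2⟩ : (_ : ℕ) × ℤ), c (k - p.1) p.2 := by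
        rw [Finset.sum_image]
        · exact Finset.sum_congr rfl fun I hI => by dsimp only; rw [← hj I hI]
        · intro I hI I' hI' h
          simp only [Sigma.mk.injEq, heq_eq_eq] at h
          exact Prod.ext (by rw [hj I hI, hj I' hI', h.1]) h.2
    _ ≤ _ := by
        refine Finset.sum_le_sum_of_subset_of_nonneg ?_ fun _ _ _ => hc _ _
        intro p hp
        obtain ⟨I, hI, rfl⟩ := Finset.mem_image.1 hp
        simp only [Finset.mem_sigma, Finset.mem_range]
        exact ⟨Nat.lt_succ_of_le (Finset.le_sup hI), hmem I hI⟩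

/-- The average of `f` over a dyadic interval. -/
def dyadicAvg {E : Type*} [NormedAddCommGroup E] [NormedSpace ℝ E] (f : ℝ → E) (k m : ℤ) : E :=
  ((2 : ℝ) ^ k)⁻¹ • ∫ x in dyadicI k m, f x

lemma dyadicAvg_split {E : Type*} [NormedAddCommGroup E] [NormedSpace ℝ E] {f : ℝ → E}
    {k m : ℤ} (hf : IntegrableOn f (dyadicI k m)) :
    dyadicAvg f k m = (1 / 2 : ℝ) •
      (dyadicAvg f (k - 1) (2 * m + 1) + dyadicAvg f (k - 1) (2 * m)) := by
  have hk : (2 : ℝ) ^ k ≠ 0 := by positivity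
  rw [dyadicAvg, dyadicAvg, dyadicAvg, two_zpow_pred, ← smul_add, smul_smul,
    ← dyadicI_left_union_right, setIntegral_union (disjoint_dyadicI_left_right k m)
      (measurableSet_dyadicI _ _) (hf.mono_set (dyadicI_left_subset k m))
      (hf.mono_set (dyadicI_right_subset k m)), add_comm]
  congr 1
  field_simp

lemma haarCoeff_eq {n : ℕ} {f : ℝ → En n} {k m : ℤ} (hf : IntegrableOn f (dyadicI k m)) :
    haarCoeff f k m = √((2 : ℝ) ^ k) • ((1 / 2 : ℝ) •
      (dyadicAvg f (k - 1) (2 * m + 1) - dyadicAvg f (k - 1) (2 * m))) := by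
  have hk : (0 : ℝ) < 2 ^ k := by positivity
  have hR := (hf.mono_set (dyadicI_right_subset k m)).integrable_indicator
    (measurableSet_dyadicI _ _)
  have hL := (hf.mono_set (dyadicI_left_subset k m)).integrable_indicator
    (measurableSet_dyadicI _ _)
  have hpt : ∀ x, haarF k m x • f x = (√((2 : ℝ) ^ k))⁻¹ •
      ((dyadicI (k - 1) (2 * m + 1)).indicator f x - (dyadicI (k - 1) (2 * m)).indicator f x) := by
    intro x
    rw [haarF, mul_smul, sub_smul]
    by_cases hr : x ∈ dyadicI (k - 1) (2 * m + 1) <;>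
      by_cases hl : x ∈ dyadicI (k - 1) (2 * m) <;> simp [hr, hl]
  simp only [haarCoeff, hpt]
  rw [integral_smul, integral_sub hR hL, integral_indicator (measurableSet_dyadicI _ _),
    integral_indicator (measurableSet_dyadicI _ _), dyadicAvg, dyadicAvg, two_zpow_pred,
    ← smul_sub, smul_smul, smul_smul]
  congr 1
  have hs : √((2 : ℝ) ^ k) * √((2 : ℝ) ^ k) = 2 ^ k := Real.mul_self_sqrt hk.le
  have hs0 : √((2 : ℝ) ^ k) ≠ 0 := (Real.sqrt_pos.2 hk).ne'
  field_simp
  linarith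

lemma norm_haarCoeff_mul {n : ℕ} {f g : ℝ → En n} {k m : ℤ}
    (hf : IntegrableOn f (dyadicI k m)) (hg : IntegrableOn g (dyadicI k m)) :
    ‖haarCoeff f k m‖ * ‖haarCoeff g k m‖ = 2 ^ k *
      (‖(1 / 2 : ℝ) • (dyadicAvg f (k - 1) (2 * m + 1) - dyadicAvg f (k - 1) (2 * m))‖ *
        ‖(1 / 2 : ℝ) • (dyadicAvg g (k - 1) (2 * m + 1) - dyadicAvg g (k - 1) (2 * m))‖) := by
  have hk : (0 : ℝ) < 2 ^ k := by positivity
  have hs : √((2 : ℝ) ^ k) * √((2 : ℝ) ^ k) = 2 ^ k := Real.mul_self_sqrt hk.le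
  rw [haarCoeff_eq hf, haarCoeff_eq hg, norm_smul (√_), norm_smul (√_),
    Real.norm_of_nonneg (Real.sqrt_nonneg _)]
  rw [mul_mul_mul_comm, hs]

lemma two_mul_norm_le {E : Type*} [NormedAddCommGroup E] (y : E) {w : ℝ} (l : ℝ) (hw : 0 < w) :
    2 * l * ‖y‖ ≤ ‖y‖ ^ 2 * w + l ^ 2 * w⁻¹ := by
  have : ‖y‖ ^ 2 * w + l ^ 2 * w⁻¹ - 2 * l * ‖y‖ = (‖y‖ * w - l) ^ 2 * w⁻¹ := by
    field_simp; ring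
  have : 0 ≤ (‖y‖ * w - l) ^ 2 * w⁻¹ := by positivity
  linarith

lemma integrableOn_of_sq_mul_weight {E : Type*} [NormedAddCommGroup E]
    {ω : ℝ → ℝ} {s : Set ℝ} {f : ℝ → E} (hω : ∀ᵐ x : ℝ, 0 < ω x)
    (hσ : IntegrableOn (fun x => (ω x)⁻¹) s) (hf : AEStronglyMeasurable f (volume.restrict s))
    (hX : IntegrableOn (fun x => ‖f x‖ ^ 2 * ω x) s) : IntegrableOn f s := by
  refine (hX.add hσ).mono' hf ?_
  filter_upwards [ae_restrict_of_ae hω] with x hx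
  have := two_mul_norm_le (f x) 1 hx
  simp only [Pi.add_apply]
  linarith [norm_nonneg (f x)]

lemma two_mul_norm_dyadicAvg_le {E : Type*} [NormedAddCommGroup E] [NormedSpace ℝ E]
    {ω : ℝ → ℝ} {f : ℝ → E} {k m : ℤ} (hω : ∀ᵐ x : ℝ, 0 < ω x)
    (hσ : IntegrableOn (fun x => (ω x)⁻¹) (dyadicI k m)) (hf : IntegrableOn f (dyadicI k m))
    (hX : IntegrableOn (fun x => ‖f x‖ ^ 2 * ω x) (dyadicI k m)) {l : ℝ} (hl : 0 ≤ l) :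
    2 * l * ‖dyadicAvg f k m‖ ≤ dyadicAvg (fun x => ‖f x‖ ^ 2 * ω x) k m
      + l ^ 2 * dyadicAvg (fun x => (ω x)⁻¹) k m := by
  have hk : (0 : ℝ) < 2 ^ k := by positivity
  have h : 2 * l * ∫ x in dyadicI k m, ‖f x‖ ≤
      (∫ x in dyadicI k m, ‖f x‖ ^ 2 * ω x) + l ^ 2 * ∫ x in dyadicI k m, (ω x)⁻¹ := by
    rw [← integral_const_mul, ← integral_const_mul,
      ← integral_add hX (Integrable.const_mul hσ _)]
    refine integral_mono_ae (Integrable.const_mul hf.norm _)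
      (hX.add (Integrable.const_mul hσ _)) ?_
    filter_upwards [ae_restrict_of_ae hω] with x hx using two_mul_norm_le (f x) l hx
  have h₁ : 2 * l * ‖∫ x in dyadicI k m, f x‖ ≤ 2 * l * ∫ x in dyadicI k m, ‖f x‖ := by
    gcongr; exact norm_integral_le_integral_norm _
  have := mul_le_mul_of_nonneg_left (h₁.trans h) (inv_nonneg.2 hk.le)
  simp only [dyadicAvg, norm_smul, smul_eq_mul, norm_inv, Real.norm_of_nonneg hk.le]
  linarith

lemma norm_sq_dyadicAvg_div_le {E : Type*} [NormedAddCommGroup E] [NormedSpace ℝ E]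
    {ω : ℝ → ℝ} {f : ℝ → E} {k m : ℤ} (hω : ∀ᵐ x : ℝ, 0 < ω x)
    (hσ : IntegrableOn (fun x => (ω x)⁻¹) (dyadicI k m)) (hf : IntegrableOn f (dyadicI k m))
    (hX : IntegrableOn (fun x => ‖f x‖ ^ 2 * ω x) (dyadicI k m))
    (hv : 0 < dyadicAvg (fun x => (ω x)⁻¹) k m) :
    ‖dyadicAvg f k m‖ ^ 2 / dyadicAvg (fun x => (ω x)⁻¹) k m
      ≤ dyadicAvg (fun x => ‖f x‖ ^ 2 * ω x) k m := by
  have h := two_mul_norm_dyadicAvg_le hω hσ hf hX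
    (l := ‖dyadicAvg f k m‖ / dyadicAvg (fun x => (ω x)⁻¹) k m) (by positivity)
  generalize dyadicAvg (fun x => (ω x)⁻¹) k m = v at *
  generalize ‖dyadicAvg f k m‖ = a at *
  have e₁ : 2 * (a / v) * a = 2 * (a ^ 2 / v) := by ring
  have e₂ : (a / v) ^ 2 * v = a ^ 2 / v := by field_simp
  linarith

lemma dyadicAvg_weight {ω : ℝ → ℝ} {k m : ℤ} (hω : ∀ᵐ x : ℝ, 0 < ω x)
    (hu : IntegrableOn ω (dyadicI k m)) (hσ : IntegrableOn (fun x => (ω x)⁻¹) (dyadicI k m)) :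
    0 < dyadicAvg ω k m ∧ 0 < dyadicAvg (fun x => (ω x)⁻¹) k m ∧
      1 ≤ dyadicAvg ω k m * dyadicAvg (fun x => (ω x)⁻¹) k m := by
  have hk : (0 : ℝ) < 2 ^ k := by positivity
  have hvol : volume.real (dyadicI k m) = 2 ^ k := by
    rw [dyadicI, Real.volume_real_Ico_of_le (by nlinarith)]; ring
  have h1 : IntegrableOn (fun _ => (1 : ℝ)) (dyadicI k m) :=
    integrableOn_const (by rw [dyadicI]; exact measure_Ico_lt_top.ne)
  have ha : dyadicAvg (fun _ => (1 : ℝ)) k m = 1 := by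
    rw [dyadicAvg, setIntegral_const, hvol, smul_eq_mul, smul_eq_mul, mul_one,
      inv_mul_cancel₀ hk.ne']
  have key : ∀ l : ℝ, 0 ≤ l →
      2 * l ≤ dyadicAvg ω k m + l ^ 2 * dyadicAvg (fun x => (ω x)⁻¹) k m := by
    intro l hl
    have := two_mul_norm_dyadicAvg_le hω hσ h1 (by simpa using hu) hl
    simpa [ha] using this
  have hu0 : 0 ≤ dyadicAvg ω k m := by
    refine smul_nonneg (by positivity) (integral_nonneg_of_ae ?_)
    filter_upwards [ae_restrict_of_ae hω] with x hx using hx.le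
  have hv0 : 0 ≤ dyadicAvg (fun x => (ω x)⁻¹) k m := by
    refine smul_nonneg (by positivity) (integral_nonneg_of_ae ?_)
    filter_upwards [ae_restrict_of_ae hω] with x hx using (inv_pos.2 hx).le
  generalize dyadicAvg ω k m = u at *
  generalize dyadicAvg (fun x => (ω x)⁻¹) k m = v at *
  have hv : 0 < v := by
    refine hv0.lt_of_ne' fun h => ?_
    have := key (u + 1) (by linarith)
    rw [h] at this; linarith
  have huv : 1 ≤ u * v := by
    have := mul_le_mul_of_nonneg_right (key v⁻¹ (by positivity)) hv.le
    have e : (u + v⁻¹ ^ 2 * v) * v = u * v + 1 := by field_simp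
    have e' : 2 * v⁻¹ * v = 2 := by field_simp
    linarith
  exact ⟨pos_of_mul_pos_left (by linarith) hv.le, hv, huv⟩

lemma dyadicAvg_mul_le_Q2dyadic {ω : ℝ → ℝ} {k m : ℤ} (hω : ∀ᵐ x : ℝ, 0 < ω x)
    (hu : IntegrableOn ω (dyadicI k m)) (hσ : IntegrableOn (fun x => (ω x)⁻¹) (dyadicI k m))
    (hQ : Q2dyadic ω < ⊤) :
    dyadicAvg ω k m * dyadicAvg (fun x => (ω x)⁻¹) k m ≤ (Q2dyadic ω).toReal := by
  have hk : (0 : ℝ) < 2 ^ k := by positivity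
  have avg : ∀ h : ℝ → ℝ, IntegrableOn h (dyadicI k m) → (∀ᵐ x : ℝ, 0 < h x) →
      (∫⁻ x in dyadicI k m, ENNReal.ofReal (h x)) / ENNReal.ofReal ((2 : ℝ) ^ k)
        = ENNReal.ofReal (dyadicAvg h k m) := by
    intro h hi hp
    rw [← ofReal_integral_eq_lintegral_ofReal hi
      ((ae_restrict_of_ae hp).mono fun x hx => le_of_lt hx), ← ENNReal.ofReal_div_of_pos hk,
      dyadicAvg, smul_eq_mul, div_eq_inv_mul]
  have hle := le_iSup₂ (f := fun k m : ℤ =>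
    ((∫⁻ x in dyadicI k m, ENNReal.ofReal (ω x)) / ENNReal.ofReal ((2 : ℝ) ^ k)) *
      ((∫⁻ x in dyadicI k m, ENNReal.ofReal ((ω x)⁻¹)) / ENNReal.ofReal ((2 : ℝ) ^ k))) k m
  have hpos := dyadicAvg_weight hω hu hσ
  rw [avg ω hu hω, avg _ hσ (hω.mono fun x hx => inv_pos.2 hx),
    ← ENNReal.ofReal_mul hpos.1.le] at hle
  exact (ENNReal.ofReal_le_iff_le_toReal hQ.ne).1 hle

/-- The Bellman function evaluated at the averages over a dyadic interval. -/
def bellmanDyadic {n : ℕ} (Q : ℝ) (ω : ℝ → ℝ) (f g : ℝ → En n) (k m : ℤ) : ℝ :=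
  2 ^ k * bellman Q (dyadicAvg (fun x => ‖f x‖ ^ 2 * ω x) k m)
    (dyadicAvg (fun x => ‖g x‖ ^ 2 * (ω x)⁻¹) k m) (dyadicAvg f k m) (dyadicAvg g k m)
    (dyadicAvg ω k m) (dyadicAvg (fun x => (ω x)⁻¹) k m)

lemma bellmanDyadic_step {n : ℕ} {ω : ℝ → ℝ} {f g : ℝ → En n} {k m : ℤ}
    (hω : ∀ᵐ x : ℝ, 0 < ω x) (hQ : Q2dyadic ω < ⊤)
    (hu : IntegrableOn ω (dyadicI k m)) (hσ : IntegrableOn (fun x => (ω x)⁻¹) (dyadicI k m))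
    (hf : IntegrableOn f (dyadicI k m)) (hg : IntegrableOn g (dyadicI k m))
    (hX : IntegrableOn (fun x => ‖f x‖ ^ 2 * ω x) (dyadicI k m))
    (hY : IntegrableOn (fun x => ‖g x‖ ^ 2 * (ω x)⁻¹) (dyadicI k m)) :
    ‖haarCoeff f k m‖ * ‖haarCoeff g k m‖
      + (bellmanDyadic (Q2dyadic ω).toReal ω f g (k - 1) (2 * m)
        + bellmanDyadic (Q2dyadic ω).toReal ω f g (k - 1) (2 * m + 1))
      ≤ bellmanDyadic (Q2dyadic ω).toReal ω f g k m := by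
  have sL := dyadicI_left_subset k m
  have sR := dyadicI_right_subset k m
  have hk : (0 : ℝ) < 2 ^ k := by positivity
  obtain ⟨-, -, w⟩ := dyadicAvg_weight hω hu hσ
  obtain ⟨uL, vL, wL⟩ := dyadicAvg_weight hω (hu.mono_set sL) (hσ.mono_set sL)
  obtain ⟨uR, vR, wR⟩ := dyadicAvg_weight hω (hu.mono_set sR) (hσ.mono_set sR)
  have q := dyadicAvg_mul_le_Q2dyadic hω hu hσ hQ
  have qL := dyadicAvg_mul_le_Q2dyadic hω (hu.mono_set sL) (hσ.mono_set sL) hQ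
  have qR := dyadicAvg_mul_le_Q2dyadic hω (hu.mono_set sR) (hσ.mono_set sR) hQ
  rw [norm_haarCoeff_mul hf hg]
  simp only [bellmanDyadic]
  rw [dyadicAvg_split hu, dyadicAvg_split hσ] at w q
  rw [dyadicAvg_split hu, dyadicAvg_split hσ, dyadicAvg_split hf, dyadicAvg_split hg,
    dyadicAvg_split hX, dyadicAvg_split hY, two_zpow_pred]
  generalize dyadicAvg ω (k - 1) (2 * m) = u₂ at *
  generalize dyadicAvg ω (k - 1) (2 * m + 1) = u₁ at *
  generalize dyadicAvg (fun x => (ω x)⁻¹) (k - 1) (2 * m) = v₂ at *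
  generalize dyadicAvg (fun x => (ω x)⁻¹) (k - 1) (2 * m + 1) = v₁ at *
  generalize dyadicAvg f (k - 1) (2 * m) = x₂ at *
  generalize dyadicAvg f (k - 1) (2 * m + 1) = x₁ at *
  generalize dyadicAvg g (k - 1) (2 * m) = y₂ at *
  generalize dyadicAvg g (k - 1) (2 * m + 1) = y₁ at *
  generalize dyadicAvg (fun x => ‖f x‖ ^ 2 * ω x) (k - 1) (2 * m) = X₂ at *
  generalize dyadicAvg (fun x => ‖f x‖ ^ 2 * ω x) (k - 1) (2 * m + 1) = X₁ at *
  generalize dyadicAvg (fun x => ‖g x‖ ^ 2 * (ω x)⁻¹) (k - 1) (2 * m) = Y₂ at *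
  generalize dyadicAvg (fun x => ‖g x‖ ^ 2 * (ω x)⁻¹) (k - 1) (2 * m + 1) = Y₁ at *
  simp only [smul_eq_mul] at w q ⊢
  have avg₁ : ∀ a b : ℝ, 1 / 2 * (a + b) + (a - b) / 2 = a := fun a b => by ring
  have avg₂ : ∀ a b : ℝ, 1 / 2 * (a + b) - (a - b) / 2 = b := fun a b => by ring
  have vec₁ : ∀ a b : En n, (1 / 2 : ℝ) • (a + b) + (1 / 2 : ℝ) • (a - b) = a :=
    fun a b => by module
  have vec₂ : ∀ a b : En n, (1 / 2 : ℝ) • (a + b) - (1 / 2 : ℝ) • (a - b) = b :=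
    fun a b => by module
  have step := bellman_step (Q := (Q2dyadic ω).toReal) (X₁ := X₁) (X₂ := X₂) (Y₁ := Y₁) (Y₂ := Y₂)
    (u := 1 / 2 * (u₁ + u₂)) (v := 1 / 2 * (v₁ + v₂)) (d := (u₁ - u₂) / 2)
    (e := (v₁ - v₂) / 2) ((1 / 2 : ℝ) • (x₁ + x₂)) ((1 / 2 : ℝ) • (x₁ - x₂))
    ((1 / 2 : ℝ) • (y₁ + y₂)) ((1 / 2 : ℝ) • (y₁ - y₂))
  rw [avg₁, avg₁, avg₂, avg₂, vec₁, vec₁, vec₂, vec₂] at step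
  have := mul_le_mul_of_nonneg_left (step uR uL vR vL w q wR qR wL qL) hk.le
  rw [show 1 / 2 * (X₁ + X₂) = (X₁ + X₂) / 2 by ring,
    show 1 / 2 * (Y₁ + Y₂) = (Y₁ + Y₂) / 2 by ring]
  linarith

/-- dimension-free bilinear embedding for vector-valued Haar
coefficients over a dyadic interval `J = [2^kJ mJ, 2^kJ (mJ+1))`. -/
theorem vector_bilinear_haar_embedding :
    ∃ c : ℝ, 0 < c ∧ ∀ n : ℕ, 1 ≤ n → ∀ ω : ℝ → ℝ,
      Measurable ω → (∀ᵐ x : ℝ, 0 < ω x) →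
      LocallyIntegrable ω → LocallyIntegrable (fun x => (ω x)⁻¹) →
      Q2dyadic ω < ⊤ →
      ∀ kJ mJ : ℤ, ∀ F : Finset (ℤ × ℤ),
        (∀ I ∈ F, dyadicI I.1 I.2 ⊆ dyadicI kJ mJ) →
        ∀ f g : ℝ → En n, Measurable f → Measurable g →
          IntegrableOn (fun x => ‖f x‖ ^ 2 * ω x) (dyadicI kJ mJ) →
          IntegrableOn (fun x => ‖g x‖ ^ 2 * (ω x)⁻¹) (dyadicI kJ mJ) →
          ((2 : ℝ) ^ kJ)⁻¹ *
              ∑ I ∈ F, ‖haarCoeff f I.1 I.2‖ * ‖haarCoeff g I.1 I.2‖ ≤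
            c * (Q2dyadic ω).toReal *
              (((2 : ℝ) ^ kJ)⁻¹ * (∫ x in dyadicI kJ mJ, ‖f x‖ ^ 2 * ω x) +
                ((2 : ℝ) ^ kJ)⁻¹ * ∫ x in dyadicI kJ mJ, ‖g x‖ ^ 2 * (ω x)⁻¹) := by
  refine ⟨84, by norm_num, ?_⟩
  intro n _ ω _ hω hωi hσi hQ k m F hF f g hfm hgm hX hY
  have hloc : ∀ {h : ℝ → ℝ}, LocallyIntegrable h → ∀ k m, IntegrableOn h (dyadicI k m) :=
    fun hh k m => (hh.integrableOn_isCompact isCompact_Icc).mono_set Set.Ico_subset_Icc_self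
  have hu := hloc hωi
  have hσ := hloc hσi
  have hω' : ∀ᵐ x : ℝ, 0 < (ω x)⁻¹ := hω.mono fun x hx => inv_pos.2 hx
  have hσ' : ∀ k m, IntegrableOn (fun x => ((ω x)⁻¹)⁻¹) (dyadicI k m) := by
    simpa only [inv_inv] using hu
  have hf : IntegrableOn f (dyadicI k m) :=
    integrableOn_of_sq_mul_weight hω (hσ k m) hfm.aestronglyMeasurable hX
  have hg : IntegrableOn g (dyadicI k m) :=
    integrableOn_of_sq_mul_weight hω' (hσ' k m) hgm.aestronglyMeasurable hY
  have hk : (0 : ℝ) < 2 ^ k := by positivity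
  have key := sum_le_of_superharmonic (c := fun k m => ‖haarCoeff f k m‖ * ‖haarCoeff g k m‖)
    (W := bellmanDyadic (Q2dyadic ω).toReal ω f g) k m (fun _ _ => by positivity) ?_ ?_ F hF
  · obtain ⟨u0, v0, h1⟩ := dyadicAvg_weight hω (hu k m) (hσ k m)
    have hle := bellman_le (X := dyadicAvg (fun x => ‖f x‖ ^ 2 * ω x) k m)
      (Y := dyadicAvg (fun x => ‖g x‖ ^ 2 * (ω x)⁻¹) k m) (dyadicAvg f k m) (dyadicAvg g k m)
      u0 v0 h1 (dyadicAvg_mul_le_Q2dyadic hω (hu k m) (hσ k m) hQ)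
    rw [inv_mul_le_iff₀ hk]
    exact key.trans (mul_le_mul_of_nonneg_left hle hk.le)
  · intro k' i hs
    obtain ⟨u0, v0, h1⟩ := dyadicAvg_weight hω (hu k' i) (hσ k' i)
    refine mul_nonneg (by positivity) (bellman_nonneg u0 v0 h1
      (dyadicAvg_mul_le_Q2dyadic hω (hu k' i) (hσ k' i) hQ) ?_ ?_)
    · exact norm_sq_dyadicAvg_div_le hω (hσ k' i) (hf.mono_set hs) (hX.mono_set hs) v0
    · have := norm_sq_dyadicAvg_div_le hω' (hσ' k' i) (hg.mono_set hs) (hY.mono_set hs)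
      simp only [inv_inv] at this
      exact this u0
  · intro k' i hs
    exact bellmanDyadic_step hω hQ (hu k' i) (hσ k' i) (hf.mono_set hs) (hg.mono_set hs)
      (hX.mono_set hs) (hY.mono_set hs)
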